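/- The family (ε(x)·η ⊗ ε(y)·η)_{(x,y) ∈ F × F} is a k-basis of the kG-module St ⊗_k St; in particular the family (ε(x)·η)_{x ∈ F} is a k-basis of the Steinberg module St. -/

import Mathlib

noncomputable section

open scoped TensorProduct

namespace SL2X

variable (p : ℕ) [Fact p.Prime]

/-- The algebraic closure of the prime field `𝔽_p`. -/
abbrev F : Type := AlgebraicClosure (ZMod p)

/-- `G = SL₂(F)`. -/
abbrev G : Type := Matrix.SpecialLinearGroup (Fin 2) (F p)

/-- The unipotent element `ε(x) = [[1,x],[0,1]]`. -/
def eps (x : F p) : G p :=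
  ⟨!![1, x; 0, 1], by simp [Matrix.det_fin_two_of]⟩

/-- The torus element `h(t) = diag(t, t⁻¹)`. -/
def h (t : (F p)ˣ) : G p :=
  ⟨!![(t : F p), 0; 0, ((t⁻¹ : (F p)ˣ) : F p)], by simp [Matrix.det_fin_two_of]⟩

/-- The Weyl element `s = [[0,1],[-1,0]]`. -/
def sG : G p :=
  ⟨!![0, 1; -1, 0], by simp [Matrix.det_fin_two_of]⟩

/-- The Borel subgroup `B` of upper triangular matrices in `G`. -/
def B : Subgroup (G p) where
  carrier := {g | (g : Matrix (Fin 2) (Fin 2) (F p)) 1 0 = 0}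
  one_mem' := by simp [Matrix.one_apply]
  mul_mem' := by
    intro a b ha hb
    simp only [Set.mem_setOf_eq] at *
    simp [Matrix.mul_apply, Fin.sum_univ_two, ha, hb]
  inv_mem' := by
    intro a ha
    simp only [Set.mem_setOf_eq] at *
    simp [Matrix.SpecialLinearGroup.coe_inv, Matrix.adjugate_fin_two, ha]

/-- The diagonal part of an element of `B`, as a unit of `F`. -/
def Bdiag (b : B p) : (F p)ˣ where
  val := ((b : G p) : Matrix (Fin 2) (Fin 2) (F p)) 0 0
  inv := ((b : G p) : Matrix (Fin 2) (Fin 2) (F p)) 1 1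
  val_inv := by
    have hdet : ((b : G p) : Matrix (Fin 2) (Fin 2) (F p)).det = 1 := (b : G p).2
    have h10 : ((b : G p) : Matrix (Fin 2) (Fin 2) (F p)) 1 0 = 0 := b.2
    rw [Matrix.det_fin_two, h10, mul_zero, sub_zero] at hdet
    exact hdet
  inv_val := by
    have hdet : ((b : G p) : Matrix (Fin 2) (Fin 2) (F p)).det = 1 := (b : G p).2
    have h10 : ((b : G p) : Matrix (Fin 2) (Fin 2) (F p)) 1 0 = 0 := b.2
    rw [Matrix.det_fin_two, h10, mul_zero, sub_zero] at hdet
    rw [mul_comm]; exact hdet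

variable (k : Type) [Field k] [IsAlgClosed k] [CharZero k]

/-- The group algebra `kG`. -/
abbrev kG : Type := MonoidAlgebra k (G p)

/-- The canonical image of a group element in the group algebra. -/
def γ (g : G p) : kG p k := MonoidAlgebra.of k (G p) g

/-- The submodule of relations defining the induced module
`M(θ) = kG ⊗_{kB} k_θ`, where the character `θ` of `T ≅ Fˣ` is extended to `B`
by letting `U` act trivially. -/
def Nmod (θ : (F p)ˣ →* kˣ) : Submodule (kG p k) (kG p k) :=
  Submodule.span (kG p k)
    {y | ∃ b : B p, y = γ p k (b : G p) - ((θ (Bdiag p b) : k)) • (1 : kG p k)}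

/-- The induced module `M(θ) = kG ⊗_{kB} k_θ`, realized as `kG / N(θ)` where
`N(θ)` is the left submodule generated by the elements `b - θ(b)·1`, `b ∈ B`. -/
def Mmod (θ : (F p)ˣ →* kˣ) : Type := kG p k ⧸ Nmod p k θ

instance (θ : (F p)ˣ →* kˣ) : AddCommGroup (Mmod p k θ) :=
  inferInstanceAs (AddCommGroup (kG p k ⧸ Nmod p k θ))
instance (θ : (F p)ˣ →* kˣ) : Module (kG p k) (Mmod p k θ) :=
  inferInstanceAs (Module (kG p k) (kG p k ⧸ Nmod p k θ))
instance (θ : (F p)ˣ →* kˣ) : Module k (Mmod p k θ) :=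
  inferInstanceAs (Module k (kG p k ⧸ Nmod p k θ))
instance (θ : (F p)ˣ →* kˣ) : IsScalarTower k (kG p k) (Mmod p k θ) :=
  inferInstanceAs (IsScalarTower k (kG p k) (kG p k ⧸ Nmod p k θ))

/-- The canonical generator `1_θ ∈ M(θ)`. -/
def oneθ (θ : (F p)ˣ →* kˣ) : Mmod p k θ :=
  Submodule.Quotient.mk (1 : kG p k)

/-- `η = (1 - s)·1_tr ∈ M(tr)`. -/
def eta : Mmod p k 1 :=
  Submodule.Quotient.mk ((1 : kG p k) - γ p k (sG p))

/-- The Steinberg module `St = kG·η ⊆ M(tr)`. -/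
def St : Submodule (kG p k) (Mmod p k 1) :=
  Submodule.span (kG p k) {eta p k}

/-- `ε(x)·η` as an element of `St`. -/
def E (x : F p) : ↥(St p k) :=
  ⟨γ p k (eps p x) • eta p k,
    Submodule.smul_mem _ _ (Submodule.mem_span_singleton_self _)⟩

/-- The action of a group element on `St`, as a `k`-linear map. -/
def gSt (g : G p) : ↥(St p k) →ₗ[k] ↥(St p k) where
  toFun v := ⟨γ p k g • (v : Mmod p k 1), Submodule.smul_mem _ _ v.2⟩
  map_add' := by intro a b; apply Subtype.ext; simp [smul_add]
  map_smul' := by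
    intro c v; apply Subtype.ext
    simp [smul_comm (γ p k g) c]

/-- `St ⊗_k St`. -/
abbrev StT : Type := ↥(St p k) ⊗[k] ↥(St p k)

/-- The diagonal action of a group element on `St ⊗_k St`. -/
def gTT (g : G p) : StT p k →ₗ[k] StT p k :=
  TensorProduct.map (gSt p k g) (gSt p k g)

/-- `ω_{x,y} = (ε(x)η ⊗ ε(y)η + ε(y)η ⊗ ε(x)η)/2`. -/
def ω (x y : F p) : StT p k :=
  (2 : k)⁻¹ • (E p k x ⊗ₜ[k] E p k y + E p k y ⊗ₜ[k] E p k x)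

/-- `ρ_{x,y} = (ε(x)η ⊗ ε(y)η − ε(y)η ⊗ ε(x)η)/2`. -/
def ρ (x y : F p) : StT p k :=
  (2 : k)⁻¹ • (E p k x ⊗ₜ[k] E p k y - E p k y ⊗ₜ[k] E p k x)

/-- `V₊`, the span of the `ω_{x,y}`. -/
def Vplus : Submodule k (StT p k) :=
  Submodule.span k {v | ∃ x y : F p, v = ω p k x y}

/-- `V₋`, the span of the `ρ_{x,y}` for `x ≠ y`. -/
def Vminus : Submodule k (StT p k) :=
  Submodule.span k {v | ∃ x y : F p, x ≠ y ∧ v = ρ p k x y}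


section

variable (K : Type) [Field K]

open Classical in
/-- The coset of `g` in `G / B = ℙ¹(F)` as a vector of `K[𝔸¹]`, where the point at infinity is
sent to `0`. -/
def affinePoint (g : G p) : F p →₀ K :=
  if g.1 1 0 = 0 then 0 else Finsupp.single (g.1 0 0 / g.1 1 0) 1

/-- The `K`-linear extension of `affinePoint` to the group algebra. -/
def affineMap : kG p K →ₗ[K] (F p →₀ K) :=
  Finsupp.linearCombination K (affinePoint p K) ∘ₗ
    (MonoidAlgebra.coeffLinearEquiv K : kG p K ≃ₗ[K] _).toLinearMap

theorem γ_mul (g g' : G p) : γ p K (g * g') = γ p K g * γ p K g' :=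
  map_mul (MonoidAlgebra.of K (G p)) g g'

theorem affineMap_γ (g : G p) : affineMap p K (γ p K g) = affinePoint p K g := by
  simp [affineMap, γ]

theorem affinePoint_mul_B (g : G p) (b : B p) :
    affinePoint p K (g * (b : G p)) = affinePoint p K g := by
  have hb : (b : G p).1 1 0 = 0 := b.2
  have hb0 : (b : G p).1 0 0 ≠ 0 := (Bdiag p b).ne_zero
  have h0 (i : Fin 2) : (g * (b : G p)).1 i 0 = g.1 i 0 * (b : G p).1 0 0 := by
    simp [Matrix.mul_apply, Fin.sum_univ_two, hb]
  rw [affinePoint, affinePoint, h0, h0, mul_div_mul_right _ _ hb0]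
  by_cases hg : g.1 1 0 = 0
  · rw [if_pos hg, if_pos (mul_eq_zero_of_left hg _)]
  · rw [if_neg hg, if_neg (mul_ne_zero hg hb0)]

theorem coe_eps_mul_sG (x : F p) : (eps p x * sG p).1 = !![-x, 1; -1, 0] := by
  change !![1, x; 0, 1] * !![0, 1; -1, 0] = _
  simp

theorem affineMap_mul_eq_zero {y : kG p K} (hy : y ∈ Nmod p K 1) (a : kG p K) :
    affineMap p K (a * y) = 0 := by
  induction hy using Submodule.span_induction generalizing a with
  | mem y hy =>
    obtain ⟨b, rfl⟩ := hy
    induction a using MonoidAlgebra.induction_on with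
    | of g =>
      change affineMap p K (γ p K g * _) = 0
      simp [mul_sub, ← γ_mul, affineMap_γ, affinePoint_mul_B]
    | add a₁ a₂ h₁ h₂ => rw [add_mul, map_add, h₁, h₂, add_zero]
    | smul c a ha => rw [smul_mul_assoc, map_smul, ha, smul_zero]
  | zero => simp
  | add y z _ _ hy hz => rw [mul_add, map_add, hy, hz, add_zero]
  | smul c y _ hy => rw [smul_eq_mul, ← mul_assoc, hy]

/-- The map `M(tr) → K[𝔸¹]` induced by `affineMap`. -/
def affineQuot : Mmod p K 1 →ₗ[K] (F p →₀ K) :=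
  ((Nmod p K 1).restrictScalars K).liftQ (affineMap p K) fun y hy => by
    simpa using affineMap_mul_eq_zero p K hy 1

theorem affineQuot_E (x : F p) :
    affineQuot p K (E p K x : Mmod p K 1) = -Finsupp.single x 1 := by
  have hE : (E p K x : Mmod p K 1) =
      Submodule.Quotient.mk (γ p K (eps p x) - γ p K (eps p x * sG p)) := by
    change Submodule.Quotient.mk (γ p K (eps p x) * (1 - γ p K (sG p))) = _
    rw [mul_sub, mul_one, γ_mul]
  rw [hE]
  change affineMap p K _ = _
  have hx : (eps p x).1 1 0 = 0 := by simp [eps]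
  rw [map_sub, affineMap_γ, affineMap_γ, affinePoint, affinePoint, if_pos hx, coe_eps_mul_sG]
  simp

theorem linearIndependent_E : LinearIndependent K (E p K) := by
  let f : ↥(St p K) →ₗ[K] (F p →₀ K) :=
    -(affineQuot p K ∘ₗ ((St p K).subtype.restrictScalars K))
  refine LinearIndependent.of_comp f ?_
  have hf : f ∘ E p K = fun x => Finsupp.single x 1 := by
    funext x
    simp [f, affineQuot_E]
  rw [hf]
  exact Finsupp.linearIndependent_single_one K (F p)

theorem γ_smul_oneθ_of_mem_B {b : G p} (hb : b ∈ B p) :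
    γ p K b • oneθ p K 1 = oneθ p K 1 := by
  have h : γ p K b - 1 ∈ Nmod p K 1 :=
    Submodule.subset_span ⟨⟨b, hb⟩, by simp⟩
  change Submodule.Quotient.mk (γ p K b * 1) = Submodule.Quotient.mk 1
  rw [mul_one]
  exact (Submodule.Quotient.eq _).2 h

theorem γ_smul_eta (g : G p) :
    γ p K g • eta p K = γ p K g • oneθ p K 1 - γ p K (g * sG p) • oneθ p K 1 := by
  have h : eta p K = (1 - γ p K (sG p)) • oneθ p K 1 := by
    change Submodule.Quotient.mk _ = Submodule.Quotient.mk (_ * 1)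
    rw [mul_one]
  rw [h, smul_smul, mul_sub, mul_one, ← γ_mul, sub_smul]

theorem oneθ_sub_mem_span (g : G p) :
    oneθ p K 1 - γ p K g • oneθ p K 1 ∈
      Submodule.span K (Set.range fun x => (E p K x : Mmod p K 1)) := by
  by_cases hg : g ∈ B p
  · rw [γ_smul_oneθ_of_mem_B p K hg, sub_self]
    exact zero_mem _
  · have hg0 : g.1 1 0 ≠ 0 := hg
    set x := g.1 0 0 / g.1 1 0
    refine Submodule.subset_span ⟨x, ?_⟩
    have hb : (eps p x * sG p)⁻¹ * g ∈ B p := by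
      change ((eps p x * sG p)⁻¹ * g).1 1 0 = 0
      rw [Matrix.SpecialLinearGroup.coe_mul, Matrix.SpecialLinearGroup.coe_inv, coe_eps_mul_sG]
      simp [Matrix.adjugate_fin_two_of, Matrix.mul_apply, Fin.sum_univ_two, x, hg0]
    have hg : γ p K g • oneθ p K 1 = γ p K (eps p x * sG p) • oneθ p K 1 := by
      conv_rhs => rw [← γ_smul_oneθ_of_mem_B p K hb]
      rw [smul_smul, ← γ_mul, mul_inv_cancel_left]
    have hx : eps p x ∈ B p := by
      change (eps p x).1 1 0 = 0
      simp [eps]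
    change γ p K (eps p x) • eta p K = _
    rw [γ_smul_eta, hg, γ_smul_oneθ_of_mem_B p K hx]

theorem span_E : Submodule.span K (Set.range (E p K)) = ⊤ := by
  refine Submodule.map_injective_of_injective
    (f := (St p K).subtype.restrictScalars K) Subtype.val_injective ?_
  rw [Submodule.map_span, ← Set.range_comp]
  refine le_antisymm (Submodule.span_le.2 ?_) ?_
  · rintro _ ⟨x, rfl⟩
    exact ⟨E p K x, trivial, rfl⟩
  · rintro _ ⟨⟨v, hv⟩, -, rfl⟩
    obtain ⟨a, rfl⟩ := Submodule.mem_span_singleton.1 hv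
    change a • eta p K ∈ Submodule.span K (Set.range fun x => (E p K x : Mmod p K 1))
    induction a using MonoidAlgebra.induction_on with
    | of g =>
      change γ p K g • eta p K ∈ _
      rw [γ_smul_eta, ← sub_sub_sub_cancel_left _ _ (oneθ p K 1)]
      exact sub_mem (oneθ_sub_mem_span p K _) (oneθ_sub_mem_span p K _)
    | add a₁ a₂ h₁ h₂ =>
      rw [add_smul]
      exact add_mem (h₁ (Submodule.smul_mem _ _ (Submodule.mem_span_singleton_self _)))
        (h₂ (Submodule.smul_mem _ _ (Submodule.mem_span_singleton_self _)))
    | smul c a ha =>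
      rw [smul_assoc]
      exact Submodule.smul_mem _ _
        (ha (Submodule.smul_mem _ _ (Submodule.mem_span_singleton_self _)))

/-- The basis `(ε(x)η)_{x ∈ F}` of the Steinberg module. -/
def basisE : Module.Basis (F p) K ↥(St p K) :=
  Module.Basis.mk (linearIndependent_E p K) (span_E p K).ge

end

/-- the family `(ε(x)η ⊗ ε(y)η)_{(x,y) ∈ F × F}` is a `k`-basis of
`St ⊗_k St`; in particular `(ε(x)η)_{x ∈ F}` is a `k`-basis of `St`. -/
theorem stmt0 (hp2 : p ≠ 2) :
    (LinearIndependent k (fun xy : F p × F p => E p k xy.1 ⊗ₜ[k] E p k xy.2) ∧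
      Submodule.span k
        (Set.range (fun xy : F p × F p => E p k xy.1 ⊗ₜ[k] E p k xy.2)) =
        (⊤ : Submodule k (StT p k))) ∧
    (LinearIndependent k (fun x : F p => E p k x) ∧
      Submodule.span k (Set.range (fun x : F p => E p k x)) =
        (⊤ : Submodule k ↥(St p k))) := by
  let b := (basisE p k).tensorProduct (basisE p k)
  have hb : ⇑b = fun xy : F p × F p => E p k xy.1 ⊗ₜ[k] E p k xy.2 := by
    funext xy
    simp [b, basisE, Module.Basis.tensorProduct_apply']
  rw [← hb]
  exact ⟨⟨b.linearIndependent, b.span_eq⟩, linearIndependent_E p k, span_E p k⟩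

end SL2X
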